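/- Fix integers n ≥ 1 and N ≥ 1. Suppose ẽ = (ẽ_1, …, ẽ_n) ∈ ℝ^n is attainable by a multisoliton of some degree Ñ: there exist distinct positive reals β̃_1, …, β̃_Ñ with ẽ_m = (−1)^{m+1}(2^{2m+1}/(2m+1)) Σ_{j=1}^{Ñ} β̃_j^{2m+1} for m = 1, …, n. Suppose e = (e_1, …, e_n) is attainable by a multisoliton of degree at most N (there exist M ≤ N and distinct positive reals γ_1, …, γ_M whose scaled odd power sums equal e_m), and ẽ_m ≤ e_m for every m = 1, …, n. Then ẽ is attainable by a multisoliton of degree at most N: there exist M' ≤ N and distinct positive reals δ_1, …, δ_{M'} with ẽ_m = (−1)^{m+1}(2^{2m+1}/(2m+1)) Σ_{j=1}^{M'} δ_j^{2m+1} for all m. -/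

import Mathlib

/-- The constraint vector `e ∈ ℝⁿ` is attainable by a multisoliton of degree `N`:
there are distinct positive reals `β_1, …, β_N` with
`e_m = (-1)^{m+1} (2^{2m+1}/(2m+1)) ∑_j β_j^{2m+1}` for `m = 1, …, n`
(the index `m : Fin n` corresponds to the mathematical index `m + 1`). -/
def AttainsDeg (n N : ℕ) (e : Fin n → ℝ) : Prop :=
  ∃ β : Fin N → ℝ, Function.Injective β ∧ (∀ j, 0 < β j) ∧
    ∀ m : Fin n, e m = (-1 : ℝ) ^ (m : ℕ) * 2 ^ (2 * (m : ℕ) + 3) /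
      (2 * (m : ℕ) + 3 : ℝ) * ∑ j, β j ^ (2 * (m : ℕ) + 3)



/-- power sums -/
noncomputable def PS {K : ℕ} (x : Fin K → ℝ) (m : ℕ) : ℝ := ∑ i, x i ^ (2 * m + 3)

/-- alternating even polynomial of degree at most `2k` -/
def AltPoly (k : ℕ) (q : ℝ → ℝ) : Prop :=
  ∃ c : ℕ → ℝ, (∀ m, 0 ≤ c m) ∧
    ∀ x, q x = ∑ m ∈ Finset.range (k + 1), (-1 : ℝ) ^ m * c m * x ^ (2 * m)

lemma altPoly_one (k : ℕ) : AltPoly k (fun _ => 1) := by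
  refine ⟨fun m => if m = 0 then 1 else 0, fun m => by dsimp only; split_ifs <;> norm_num, fun x => ?_⟩
  rw [Finset.sum_eq_single 0] <;> simp +contextual

lemma altPoly_mul {k : ℕ} {q : ℝ → ℝ} (h : AltPoly k q) {r : ℝ} (hr : 0 ≤ r) :
    AltPoly (k + 1) (fun x => (r - x ^ 2) * q x) := by
  obtain ⟨c, hc, hq⟩ := h
  refine ⟨fun m => r * (if m < k + 1 then c m else 0) + (if m = 0 then 0 else c (m - 1)),
    fun m => ?_, fun x => ?_⟩
  · have := hc m
    have := hc (m - 1)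
    dsimp only
    split_ifs <;> positivity
  · simp only [hq]
    have e1 : ∑ m ∈ Finset.range (k + 1 + 1), (-1 : ℝ) ^ m *
        (r * (if m < k + 1 then c m else 0) + (if m = 0 then 0 else c (m - 1))) * x ^ (2 * m)
        = ∑ m ∈ Finset.range (k + 1 + 1), (-1 : ℝ) ^ m *
        (r * (if m < k + 1 then c m else 0)) * x ^ (2 * m) +
        ∑ m ∈ Finset.range (k + 1 + 1), (-1 : ℝ) ^ m *
        (if m = 0 then 0 else c (m - 1)) * x ^ (2 * m) := by
      rw [← Finset.sum_add_distrib]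
      exact Finset.sum_congr rfl fun m _ => by ring
    rw [e1, Finset.sum_range_succ _ (k + 1), Finset.sum_range_succ' _ (k + 1)]
    have e2 : ∑ m ∈ Finset.range (k + 1), (-1 : ℝ) ^ m *
        (r * (if m < k + 1 then c m else 0)) * x ^ (2 * m)
        = r * ∑ m ∈ Finset.range (k + 1), (-1 : ℝ) ^ m * c m * x ^ (2 * m) := by
      rw [Finset.mul_sum]
      refine Finset.sum_congr rfl fun m hm => ?_
      rw [if_pos (Finset.mem_range.1 hm)]; ring
    have e3 : ∑ m ∈ Finset.range (k + 1), (-1 : ℝ) ^ (m + 1) *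
        (if m + 1 = 0 then 0 else c (m + 1 - 1)) * x ^ (2 * (m + 1))
        = - x ^ 2 * ∑ m ∈ Finset.range (k + 1), (-1 : ℝ) ^ m * c m * x ^ (2 * m) := by
      rw [Finset.mul_sum]
      refine Finset.sum_congr rfl fun m hm => ?_
      simp only [Nat.add_eq_zero_iff, one_ne_zero, and_false, if_false, Nat.add_sub_cancel]
      ring
    rw [e2, e3]
    simp
    ring

lemma sepPoly {K : ℕ} {δ γ : Fin K → ℝ} (hδ : Monotone δ) (hγ : Monotone γ)
    (hδ0 : ∀ i, 0 ≤ δ i) (hγ0 : ∀ i, 0 ≤ γ i) (k : ℕ) :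
    ∀ (σ : ℝ), (σ = 1 ∨ σ = -1) → ∀ a : ℕ,
    (¬ ∃ t : ℕ → Fin K, (∀ m ≤ k, a ≤ (t m : ℕ)) ∧ (∀ m, m < k → t m < t (m + 1)) ∧
      ∀ m ≤ k, 0 < σ * (-1) ^ m * (δ (t m) - γ (t m))) →
    ∃ q : ℝ → ℝ, AltPoly k q ∧
      (∀ x, 0 ≤ x → (∀ i : Fin K, a ≤ (i : ℕ) → x < min (γ i) (δ i)) → 0 < q x) ∧
      ∀ i : Fin K, a ≤ (i : ℕ) → ∀ x, min (γ i) (δ i) < x → x < max (γ i) (δ i) →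
        0 < -σ * (δ i - γ i) * q x := by
  have key : ∀ (σ : ℝ), (σ = 1 ∨ σ = -1) → ∀ i : Fin K, ∀ x, min (γ i) (δ i) < x →
      x < max (γ i) (δ i) → ¬ (0 < σ * (δ i - γ i)) → 0 < -σ * (δ i - γ i) := by
    intro σ hσ i x h1 h2 h3
    have hne : δ i ≠ γ i := by
      intro h; rw [h] at h1 h2; simp at h1 h2; linarith
    have : σ * (δ i - γ i) ≠ 0 := by
      apply mul_ne_zero
      · rcases hσ with h | h <;> rw [h] <;> norm_num
      · exact sub_ne_zero.2 hne
    have := lt_of_le_of_ne (not_lt.1 h3) this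
    linarith
  have triv : ∀ (k : ℕ) (σ : ℝ), (σ = 1 ∨ σ = -1) → ∀ a : ℕ,
      (∀ i : Fin K, a ≤ (i : ℕ) → ¬ (0 < σ * (δ i - γ i))) →
    ∃ q : ℝ → ℝ, AltPoly k q ∧
      (∀ x, 0 ≤ x → (∀ i : Fin K, a ≤ (i : ℕ) → x < min (γ i) (δ i)) → 0 < q x) ∧
      ∀ i : Fin K, a ≤ (i : ℕ) → ∀ x, min (γ i) (δ i) < x → x < max (γ i) (δ i) →
        0 < -σ * (δ i - γ i) * q x := by
    intro k σ hσ a h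
    refine ⟨fun _ => 1, altPoly_one k, fun _ _ _ => one_pos, fun i hi x h1 h2 => ?_⟩
    rw [mul_one]
    exact key σ hσ i x h1 h2 (h i hi)
  induction k with
  | zero =>
    intro σ hσ a hno
    apply triv 0 σ hσ a
    intro i hi h
    exact hno ⟨fun _ => i, fun _ _ => hi, fun m hm => absurd hm (by simp), fun m hm => by
      have : m = 0 := by omega
      subst this; simpa using h⟩
  | succ k ih =>
    intro σ hσ a hno
    by_cases hex : ∃ b : ℕ, ∃ hb : b < K, a ≤ b ∧ 0 < σ * (δ ⟨b, hb⟩ - γ ⟨b, hb⟩)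
    swap
    · apply triv _ σ hσ a
      intro i hi h
      exact hex ⟨i, i.2, hi, h⟩
    classical
    obtain ⟨hb, hab, hpos⟩ := Nat.find_spec hex
    have hmin : ∀ i : Fin K, a ≤ (i : ℕ) → (i : ℕ) < Nat.find hex →
        ¬ (0 < σ * (δ i - γ i)) := by
      intro i hi hlt h
      exact Nat.find_min hex hlt ⟨i.2, hi, h⟩
    generalize Nat.find hex = b at hb hab hpos hmin
    obtain ⟨q, hq, hq1, hq2⟩ := ih (-σ) (by rcases hσ with h | h <;> simp [h]) b (by
      rintro ⟨t, ht1, ht2, ht3⟩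
      apply hno
      have hlt : (⟨b, hb⟩ : Fin K) < t 0 := by
        rcases lt_or_eq_of_le (show (⟨b, hb⟩ : Fin K) ≤ t 0 from ht1 0 (by omega)) with h | h
        · exact h
        · have := ht3 0 (by omega)
          rw [← h] at this
          simp at this; linarith
      refine ⟨fun m => if m = 0 then ⟨b, hb⟩ else t (m - 1), ?_, ?_, ?_⟩
      · intro m hm
        rcases m with _ | m
        · simpa using hab
        · simpa using hab.trans (ht1 m (by omega))
      · intro m hm
        rcases m with _ | m
        · simpa using hlt
        · simpa using ht2 m (by omega)
      · intro m hm
        rcases m with _ | m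
        · simpa using hpos
        · have := ht3 m (by omega)
          simp only [Nat.add_eq_zero_iff, one_ne_zero, and_false, if_false, Nat.add_sub_cancel]
          convert this using 1
          ring)
    set c := min (γ ⟨b, hb⟩) (δ ⟨b, hb⟩) with hc
    have hc0 : 0 ≤ c := le_min (hγ0 _) (hδ0 _)
    have hcle : ∀ i : Fin K, b ≤ (i : ℕ) → c ≤ min (γ i) (δ i) := fun i hi =>
      min_le_min (hγ (show (⟨b, hb⟩ : Fin K) ≤ i from hi)) (hδ (show (⟨b, hb⟩ : Fin K) ≤ i from hi))
    have hsq : ∀ x, 0 ≤ x → x < c → 0 < c ^ 2 - x ^ 2 := fun x hx hxc => by nlinarith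
    refine ⟨fun x => (c ^ 2 - x ^ 2) * q x, altPoly_mul hq (sq_nonneg c), ?_, ?_⟩
    · intro x hx h
      exact mul_pos (hsq x hx (h ⟨b, hb⟩ hab))
        (hq1 x hx fun i hi => (h ⟨b, hb⟩ hab).trans_le (hcle i hi))
    · intro i hi x h1 h2
      by_cases hib : (i : ℕ) < b
      · have hk := key σ hσ i x h1 h2 (hmin i hi hib)
        have hx0 : 0 ≤ x := (le_min (hγ0 i) (hδ0 i)).trans h1.le
        have m1 : γ i ≤ γ ⟨b, hb⟩ := hγ (show i ≤ (⟨b, hb⟩ : Fin K) from hib.le)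
        have m2 : δ i ≤ δ ⟨b, hb⟩ := hδ (show i ≤ (⟨b, hb⟩ : Fin K) from hib.le)
        have hxc : x < c := by
          refine h2.trans_le ?_
          rcases hσ with h | h <;> rw [h] at hk hpos
          · refine max_le (le_min m1 ?_) (le_min ?_ m2) <;> linarith
          · refine max_le (le_min m1 ?_) (le_min ?_ m2) <;> linarith
        exact mul_pos hk (mul_pos (hsq x hx0 hxc)
          (hq1 x hx0 fun i hi => hxc.trans_le (hcle i hi)))
      · have := hq2 i (by omega) x h1 h2
        have hcx : c < x := (hcle i (by omega)).trans_lt h1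
        have : 0 < (x ^ 2 - c ^ 2) * (- -σ * (δ i - γ i) * q x) := by
          apply mul_pos _ this
          nlinarith
        convert this using 1
        ring

/-- Comparison lemma. -/
lemma compare {n K : ℕ} (hn : 1 ≤ n) {δ γ : Fin K → ℝ} (hδ : Monotone δ) (hγ : Monotone γ)
    (hδ0 : ∀ i, 0 ≤ δ i) (hγ0 : ∀ i, 0 ≤ γ i)
    (h : ∀ m < n, (-1 : ℝ) ^ m * PS δ m ≤ (-1) ^ m * PS γ m) (hne : δ ≠ γ) :
    ∃ t : ℕ → Fin K, (∀ m, m + 1 < n → t m < t (m + 1)) ∧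
      ∀ m < n, 0 < (-1) ^ m * (γ (t m) - δ (t m)) := by
  obtain ⟨k, rfl⟩ : ∃ k, n = k + 1 := ⟨n - 1, by omega⟩
  by_contra hno
  obtain ⟨q, ⟨c, hc, hqc⟩, -, hq2⟩ := sepPoly hδ hγ hδ0 hγ0 k (-1) (Or.inr rfl) 0 (by
    rintro ⟨t, -, h2, h3⟩
    refine hno ⟨t, fun m hm => h2 m (by omega), fun m hm => ?_⟩
    have := h3 m (by omega)
    linarith)
  let Q : ℝ → ℝ := fun x => ∑ m ∈ Finset.range (k + 1),
    (-1 : ℝ) ^ m * c m / (2 * m + 3) * x ^ (2 * m + 3)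
  have hQd : ∀ x, HasDerivAt Q (x ^ 2 * q x) x := by
    intro x
    have : HasDerivAt Q (∑ m ∈ Finset.range (k + 1),
        (-1 : ℝ) ^ m * c m / (2 * m + 3) * (((2 * m + 3 : ℕ) : ℝ) * x ^ (2 * m + 3 - 1))) x := by
      apply HasDerivAt.fun_sum
      intro m _
      exact (hasDerivAt_pow (2 * m + 3) x).const_mul _
    convert this using 1
    rw [hqc, Finset.mul_sum]
    refine Finset.sum_congr rfl fun m _ => ?_
    have : (2 * (m : ℝ) + 3) ≠ 0 := by positivity
    push_cast
    field_simp
    ring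
  have hQc : Continuous Q := continuous_iff_continuousAt.2 fun x => (hQd x).continuousAt
  have hterm : ∀ i, δ i ≠ γ i → 0 < Q (δ i) - Q (γ i) := by
    intro i hi
    rcases lt_or_gt_of_ne hi with hlt | hlt
    · have : StrictAntiOn Q (Set.Icc (δ i) (γ i)) := by
        apply strictAntiOn_of_deriv_neg (convex_Icc _ _) hQc.continuousOn
        intro x hx
        rw [interior_Icc] at hx
        rw [(hQd x).deriv]
        have h3 := hq2 i (Nat.zero_le _) x (by rw [min_eq_right hlt.le]; exact hx.1)
          (by rw [max_eq_left hlt.le]; exact hx.2)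
        have hx0 : 0 < x := (hδ0 i).trans_lt hx.1
        have : q x < 0 := by
          by_contra hh
          push Not at hh
          nlinarith
        have : 0 < x ^ 2 := by positivity
        nlinarith
      have := this (Set.left_mem_Icc.2 hlt.le) (Set.right_mem_Icc.2 hlt.le) hlt
      linarith
    · have : StrictMonoOn Q (Set.Icc (γ i) (δ i)) := by
        apply strictMonoOn_of_deriv_pos (convex_Icc _ _) hQc.continuousOn
        intro x hx
        rw [interior_Icc] at hx
        rw [(hQd x).deriv]
        have h3 := hq2 i (Nat.zero_le _) x (by rw [min_eq_left hlt.le]; exact hx.1)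
          (by rw [max_eq_right hlt.le]; exact hx.2)
        have hx0 : 0 < x := (hγ0 i).trans_lt hx.1
        have : 0 < q x := by
          by_contra hh
          push Not at hh
          nlinarith
        positivity
      have := this (Set.left_mem_Icc.2 hlt.le) (Set.right_mem_Icc.2 hlt.le) hlt
      linarith
  have hpos : 0 < ∑ i, (Q (δ i) - Q (γ i)) := by
    obtain ⟨i, hi⟩ := Function.ne_iff.1 hne
    apply Finset.sum_pos'
    · intro j _
      by_cases hj : δ j = γ j
      · rw [hj, sub_self]
      · exact (hterm j hj).le
    · exact ⟨i, Finset.mem_univ _, hterm i hi⟩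
  have heq : ∑ i, (Q (δ i) - Q (γ i)) = ∑ m ∈ Finset.range (k + 1),
      c m / (2 * m + 3) * ((-1) ^ m * PS δ m - (-1) ^ m * PS γ m) := by
    simp only [Q, PS]
    rw [Finset.sum_sub_distrib, Finset.sum_comm, Finset.sum_comm (γ := Fin K),
      ← Finset.sum_sub_distrib]
    refine Finset.sum_congr rfl fun m _ => ?_
    rw [← Finset.mul_sum, ← Finset.mul_sum]
    ring
  have : ∑ m ∈ Finset.range (k + 1),
      c m / (2 * m + 3) * ((-1) ^ m * PS δ m - (-1) ^ m * PS γ m) ≤ 0 := by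
    apply Finset.sum_nonpos
    intro m hm
    apply mul_nonpos_of_nonneg_of_nonpos
    · have := hc m; positivity
    · have := h m (Finset.mem_range.1 hm); linarith
  linarith

lemma local_open {n : ℕ} (u : Fin n → ℝ) (hu : ∀ i, 0 < u i) (hinj : Function.Injective u) :
    Filter.map (fun v : Fin n → ℝ => fun m : Fin n => PS v m) (nhds u)
      = nhds (fun m : Fin n => PS u m) := by
  classical
  let A : Matrix (Fin n) (Fin n) ℝ := fun m i => ((2 * (m : ℕ) + 3 : ℕ) : ℝ) * u i ^ (2 * (m : ℕ) + 2)
  have hA : A = Matrix.diagonal (fun m : Fin n => ((2 * (m : ℕ) + 3 : ℕ) : ℝ)) *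
      (Matrix.vandermonde (fun i => u i ^ 2)).transpose *
      Matrix.diagonal (fun i => u i ^ 2) := by
    ext m i
    rw [Matrix.mul_diagonal, Matrix.diagonal_mul]
    simp only [A, Matrix.transpose_apply, Matrix.vandermonde_apply]
    ring
  have hdet : A.det ≠ 0 := by
    rw [hA, Matrix.det_mul, Matrix.det_mul, Matrix.det_diagonal, Matrix.det_diagonal,
      Matrix.det_transpose]
    refine mul_ne_zero (mul_ne_zero ?_ ?_) ?_
    · exact Finset.prod_ne_zero_iff.2 fun i _ => by positivity
    · rw [Matrix.det_vandermonde_ne_zero_iff]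
      intro i j hij
      exact hinj ((sq_eq_sq₀ (hu i).le (hu j).le).1 hij)
    · exact Finset.prod_ne_zero_iff.2 fun i _ => pow_ne_zero _ (hu i).ne'
  let f' : (Fin n → ℝ) →L[ℝ] (Fin n → ℝ) := LinearMap.toContinuousLinearMap (Matrix.toLin' A)
  have hf : HasStrictFDerivAt (fun v : Fin n → ℝ => fun m : Fin n => PS v m) f' u := by
    rw [hasStrictFDerivAt_pi']
    intro m
    have h1 : HasStrictFDerivAt (fun v : Fin n → ℝ => PS v m)
        (∑ i, (((2 * (m : ℕ) + 3 : ℕ) : ℝ) * u i ^ (2 * (m : ℕ) + 2)) •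
          (ContinuousLinearMap.proj (R := ℝ) (φ := fun _ : Fin n => ℝ) i)) u := by
      unfold PS
      apply HasStrictFDerivAt.fun_sum
      intro i _
      have h2 := (hasStrictDerivAt_pow (2 * (m : ℕ) + 3) (u i)).comp_hasStrictFDerivAt u
        (ContinuousLinearMap.proj (R := ℝ) (φ := fun _ : Fin n => ℝ) i).hasStrictFDerivAt
      exact h2
    have h3 : (ContinuousLinearMap.proj (R := ℝ) (φ := fun _ : Fin n => ℝ) m).comp f' =
        (∑ i, (((2 * (m : ℕ) + 3 : ℕ) : ℝ) * u i ^ (2 * (m : ℕ) + 2)) •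
          (ContinuousLinearMap.proj (R := ℝ) (φ := fun _ : Fin n => ℝ) i)) := by
      apply ContinuousLinearMap.ext
      intro v
      simp [f', A]
      rfl
    rw [← h3] at h1
    exact h1
  apply hf.map_nhds_eq_of_surj
  rw [LinearMap.range_eq_top]
  have : IsUnit A := (Matrix.isUnit_iff_isUnit_det A).2 (isUnit_iff_ne_zero.2 hdet)
  exact Matrix.mulVec_surjective_iff_isUnit.2 this

lemma PS_succ {n : ℕ} (x : Fin (n + 1) → ℝ) (m : ℕ) :
    PS x m = x 0 ^ (2 * m + 3) + PS (fun i : Fin n => x i.succ) m := by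
  unfold PS; rw [Fin.sum_univ_succ]

lemma PS_continuous {K : ℕ} (m : ℕ) : Continuous (fun x : Fin K → ℝ => PS x m) := by
  unfold PS; fun_prop

lemma local_move {n : ℕ} (x : Fin (n + 1) → ℝ) (hx : ∀ i, 0 < x i) (hinj : Function.Injective x)
    (ε : ℝ) (hε : 0 < ε) : ∃ η > 0, ∀ s, |s - x 0| < η → ∃ y : Fin (n + 1) → ℝ, y 0 = s ∧
      (∀ i : Fin n, |y i.succ - x i.succ| < ε) ∧ ∀ m < n, PS y m = PS x m := by
  have h := local_open (fun i : Fin n => x i.succ) (fun i => hx _)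
    (hinj.comp (Fin.succ_injective n))
  have h1 : {v : Fin n → ℝ | ∀ i, |v i - x i.succ| < ε} ∈ nhds (fun i : Fin n => x i.succ) := by
    apply IsOpen.mem_nhds
    · simp only [Set.ofPred_forall]
      exact isOpen_iInter_of_finite fun i => isOpen_lt (by fun_prop) continuous_const
    · intro i; simpa using hε
  have h2 := Filter.image_mem_map (m := fun v : Fin n → ℝ => fun m : Fin n => PS v m) h1
  rw [h] at h2
  have h3 : Filter.Tendsto (fun s : ℝ => fun m : Fin n => PS x m - s ^ (2 * (m : ℕ) + 3))
      (nhds (x 0)) (nhds (fun m : Fin n => PS (fun i : Fin n => x i.succ) m)) := by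
    have hc : Continuous (fun s : ℝ => fun m : Fin n => PS x m - s ^ (2 * (m : ℕ) + 3)) := by
      fun_prop
    convert hc.tendsto (x 0) using 2
    funext m
    rw [PS_succ x]; ring
  obtain ⟨η, hη, hs⟩ := Metric.eventually_nhds_iff.1 (h3.eventually h2)
  refine ⟨η, hη, fun s hss => ?_⟩
  obtain ⟨v, hv, hve⟩ := hs (y := s) (by rwa [Real.dist_eq])
  refine ⟨Fin.cons s v, by simp, fun i => by simpa using hv i, fun m hm => ?_⟩
  have := congrFun hve ⟨m, hm⟩
  simp only at this
  rw [PS_succ]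
  simp only [Fin.cons_zero, Fin.cons_succ]
  change s ^ (2 * m + 3) + PS v m = _
  rw [this]; ring

lemma index_full {n : ℕ} (t : ℕ → Fin (n + 1)) (h0 : t 0 ≠ 0)
    (ht : ∀ m, m + 1 < n → t m < t (m + 1)) : ∀ m < n, (t m : ℕ) = m + 1 := by
  have lo : ∀ m < n, m + 1 ≤ (t m : ℕ) := by
    intro m
    induction m with
    | zero => intro _; have : (t 0 : ℕ) ≠ 0 := fun h => h0 (Fin.ext h); omega
    | succ m ih =>
      intro hm
      have h1 := ih (by omega)
      have h2 : (t m : ℕ) < t (m + 1) := ht m hm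
      omega
  have hi : ∀ j m, m + j + 1 = n → (t m : ℕ) ≤ m + 1 := by
    intro j
    induction j with
    | zero => intro m hm; have := (t m).2; omega
    | succ j ih =>
      intro m hm
      have h1 := ih (m + 1) (by omega)
      have h2 : (t m : ℕ) < t (m + 1) := ht m (by omega)
      omega
  intro m hm
  have := lo m hm
  have := hi (n - 1 - m) m (by omega)
  omega

lemma alt_all {n : ℕ} (hn : 1 ≤ n) {y x : Fin (n + 1) → ℝ} (hy : Monotone y) (hx : Monotone x)
    (hy0 : ∀ i, 0 ≤ y i) (hx0 : ∀ i, 0 ≤ x i) (h : ∀ m < n, PS y m = PS x m)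
    {σ : ℝ} (hσ : σ = 1 ∨ σ = -1) (h0 : 0 < σ * (y 0 - x 0)) :
    ∀ i : Fin (n + 1), 0 < σ * (-1) ^ (i : ℕ) * (y i - x i) := by
  have hne : y ≠ x := by rintro rfl; simp at h0
  have main : ∃ t : ℕ → Fin (n + 1), (∀ m, m + 1 < n → t m < t (m + 1)) ∧
      ∀ m < n, 0 < (-1) ^ m * (σ * (x (t m) - y (t m))) := by
    rcases hσ with rfl | rfl
    · obtain ⟨t, h1, h2⟩ := compare hn hy hx hy0 hx0 (fun m hm => (by rw [h m hm])) hne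
      exact ⟨t, h1, fun m hm => by simpa using h2 m hm⟩
    · obtain ⟨t, h1, h2⟩ := compare hn hx hy hx0 hy0 (fun m hm => (by rw [h m hm])) hne.symm
      exact ⟨t, h1, fun m hm => by simpa using h2 m hm⟩
  obtain ⟨t, h1, h2⟩ := main
  have ht := index_full t (by
    intro h
    have := h2 0 (by omega)
    rw [h] at this
    simp at this; linarith) h1
  intro i
  refine Fin.cases ?_ (fun j => ?_) i
  · simpa using h0
  · have e : t j = j.succ := Fin.ext (by simpa using ht j j.2)
    have := h2 j j.2
    rw [e] at this
    simp only [Fin.val_succ, pow_succ]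
    linarith

lemma first_ne {n : ℕ} (hn : 1 ≤ n) {y x : Fin (n + 1) → ℝ} (hy : Monotone y) (hx : Monotone x)
    (hy0 : ∀ i, 0 ≤ y i) (hx0 : ∀ i, 0 ≤ x i) (h : ∀ m < n, PS y m = PS x m)
    (hne : y ≠ x) : y 0 ≠ x 0 := by
  intro he
  obtain ⟨t, h1, h2⟩ := compare hn hy hx hy0 hx0 (fun m hm => (by rw [h m hm])) hne
  obtain ⟨t', h1', h2'⟩ := compare hn hx hy hx0 hy0 (fun m hm => (by rw [h m hm])) hne.symm
  have ht := index_full t (by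
    intro h
    have := h2 0 (by omega)
    rw [h] at this
    simp [he] at this) h1
  have ht' := index_full t' (by
    intro h
    have := h2' 0 (by omega)
    rw [h] at this
    simp [he] at this) h1'
  have e : t 0 = t' 0 := Fin.ext (by rw [ht 0 hn, ht' 0 hn])
  have a := h2 0 hn
  have b := h2' 0 hn
  rw [e] at a
  simp at a b; linarith

lemma core {n : ℕ} (hn : 1 ≤ n) (x : Fin (n + 1) → ℝ) (σ : ℝ) (hσ : σ = 1 ∨ σ = -1)
    (hmono : Monotone x) (hx0 : ∀ i, 0 ≤ x i)
    (gap : ∀ i : Fin n, 0 < σ * (-1) ^ (i : ℕ) → x i.castSucc < x i.succ)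
    (pos : ∀ i : Fin (n + 1), σ * (-1) ^ (i : ℕ) < 0 → 0 < x i) (ε : ℝ) (hε : 0 < ε) :
    ∃ y : Fin (n + 1) → ℝ, (∀ m < n, PS y m = PS x m) ∧
      (∀ i : Fin (n + 1), 0 < σ * (-1) ^ (i : ℕ) * (y i - x i)) ∧
      (∀ i, |y i - x i| < ε) ∧ (∀ i, 0 < y i) ∧ StrictMono y := by
  set s : Fin (n + 1) → ℝ := fun i => σ * (-1) ^ (i : ℕ) with hs
  have hs1 : ∀ i, s i = 1 ∨ s i = -1 := by
    intro i
    rcases hσ with h | h <;> rcases neg_one_pow_eq_or ℝ (i : ℕ) with h' | h' <;>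
      simp [hs, h, h']
  have hss : ∀ i, s i * s i = 1 := fun i => by rcases hs1 i with h | h <;> rw [h] <;> norm_num
  have hsucc : ∀ i : Fin n, s i.succ = - s i.castSucc := by
    intro i; simp only [hs, Fin.val_succ, Fin.val_castSucc, pow_succ]; ring
  have ev : ∀ᶠ e in nhdsWithin (0 : ℝ) (Set.Ioi 0), (0 < e ∧ e < ε) ∧
      (∀ i, s i < 0 → 3 * e < x i) ∧
      (∀ i : Fin n, 0 < s i.castSucc → x i.castSucc + 5 * e < x i.succ) := by
    refine Filter.Eventually.and (Filter.Eventually.and self_mem_nhdsWithin ?_)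
      (Filter.Eventually.and ?_ ?_)
    · exact nhdsWithin_le_nhds (eventually_lt_nhds hε)
    · rw [Filter.eventually_all]
      intro i
      by_cases h : s i < 0
      · have hc : Continuous (fun e : ℝ => 3 * e) := by fun_prop
        have := (hc.tendsto 0).eventually (eventually_lt_nhds (b := x i) (by simpa using pos i h))
        exact nhdsWithin_le_nhds (this.mono fun _ h _ => h)
      · exact Filter.Eventually.of_forall fun _ h' => absurd h' h
    · rw [Filter.eventually_all]
      intro i
      by_cases h : 0 < s i.castSucc
      · have hc : Continuous (fun e : ℝ => x i.castSucc + 5 * e) := by fun_prop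
        have := (hc.tendsto 0).eventually (eventually_lt_nhds (b := x i.succ)
          (by simpa using gap i h))
        exact nhdsWithin_le_nhds (this.mono fun _ h _ => h)
      · exact Filter.Eventually.of_forall fun _ h' => absurd h' h
  obtain ⟨e, ⟨he, heε⟩, hpos, hgap⟩ := ev.exists
  let Y : (Fin (n + 1) → ℝ) → Fin (n + 1) → ℝ := fun v i => x i + s i * v i
  have Y0 : ∀ v : Fin (n + 1) → ℝ, (∀ i, 0 ≤ v i) → (∀ i, v i ≤ 2 * e) → ∀ i, 0 ≤ Y v i := by
    intro v h1 h2 i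
    have a := h1 i; have b := h2 i; have c := hx0 i
    simp only [Y]
    rcases hs1 i with h | h
    · rw [h]; linarith
    · have := hpos i (by rw [h]; norm_num)
      rw [h]; linarith
  have Ypos : ∀ v : Fin (n + 1) → ℝ, (∀ i, 0 < v i) → (∀ i, v i ≤ 2 * e) → ∀ i, 0 < Y v i := by
    intro v h1 h2 i
    have a := h1 i; have b := h2 i; have c := hx0 i
    simp only [Y]
    rcases hs1 i with h | h
    · rw [h]; linarith
    · have := hpos i (by rw [h]; norm_num)
      rw [h]; linarith
  have Ym : ∀ v : Fin (n + 1) → ℝ, (∀ i, 0 ≤ v i) → (∀ i, v i ≤ 2 * e) → Monotone (Y v) := by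
    intro v h1 h2
    rw [Fin.monotone_iff_le_succ]
    intro i
    have a := h1 i.castSucc; have b := h2 i.castSucc
    have a' := h1 i.succ; have b' := h2 i.succ
    have c : x i.castSucc ≤ x i.succ := hmono (Fin.castSucc_le_succ i)
    simp only [Y]
    rw [hsucc]
    rcases hs1 i.castSucc with h | h
    · have := hgap i (by rw [h]; norm_num)
      rw [h]; linarith
    · rw [h]; linarith
  have Ysm : ∀ v : Fin (n + 1) → ℝ, (∀ i, 0 < v i) → (∀ i, v i ≤ 2 * e) → StrictMono (Y v) := by
    intro v h1 h2
    rw [Fin.strictMono_iff_lt_succ]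
    intro i
    have a := h1 i.castSucc; have b := h2 i.castSucc
    have a' := h1 i.succ; have b' := h2 i.succ
    have c : x i.castSucc ≤ x i.succ := hmono (Fin.castSucc_le_succ i)
    simp only [Y]
    rw [hsucc]
    rcases hs1 i.castSucc with h | h
    · have := hgap i (by rw [h]; norm_num)
      rw [h]; linarith
    · rw [h]; linarith
  have Yc : Continuous Y := by fun_prop
  have Yd : ∀ v w i, s i * (Y v i - Y w i) = v i - w i := by
    intro v w i
    have := hss i
    simp only [Y]
    linear_combination (v i - w i) * this
  have stepA : ∀ η, 0 < η → η ≤ e → ∃ v : Fin (n + 1) → ℝ, (∀ i, η ≤ v i) ∧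
      (∀ i, v i ≤ η + e) ∧ (∀ m < n, PS (Y v) m = PS (Y fun _ => η) m) ∧
      ∏ i, (v i - η - e) = 0 := by
    intro η hη hηe
    let S : Set (Fin (n + 1) → ℝ) := Set.Icc (fun _ => η) (fun _ => η + e) ∩
      {v | ∀ m < n, PS (Y v) m = PS (Y fun _ => η) m}
    have hSc : IsCompact S := by
      apply isCompact_Icc.inter_right
      simp only [Set.ofPred_forall]
      refine isClosed_iInter fun m => isClosed_iInter fun _ => ?_
      exact isClosed_eq ((PS_continuous m).comp Yc) continuous_const
    have hSn : S.Nonempty := ⟨fun _ => η, ⟨⟨le_rfl, fun _ => by simp; linarith⟩, fun _ _ => rfl⟩⟩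
    obtain ⟨v, hv, hmax⟩ := hSc.exists_isMaxOn hSn (f := fun v => v 0)
      (continuous_apply 0).continuousOn
    have hv1 : ∀ i, η ≤ v i := hv.1.1
    have hv2 : ∀ i, v i ≤ η + e := hv.1.2
    refine ⟨v, hv1, hv2, hv.2, ?_⟩
    by_contra hprod
    have hlt : ∀ i, v i < η + e := by
      intro i
      refine lt_of_le_of_ne (hv2 i) fun h => hprod ?_
      exact Finset.prod_eq_zero (Finset.mem_univ i) (by rw [h]; ring)
    have ev2 : ∀ᶠ d in nhdsWithin (0 : ℝ) (Set.Ioi 0), (0 < d ∧ d < η) ∧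
        (∀ i, d < η + e - v i) := by
      refine Filter.Eventually.and (Filter.Eventually.and self_mem_nhdsWithin ?_) ?_
      · exact nhdsWithin_le_nhds (eventually_lt_nhds hη)
      · rw [Filter.eventually_all]
        intro i
        exact nhdsWithin_le_nhds (eventually_lt_nhds (by have := hlt i; linarith))
    obtain ⟨d, ⟨hd, hdη⟩, hdv⟩ := ev2.exists
    have vpos : ∀ i, 0 < v i := fun i => hη.trans_le (hv1 i)
    have v2e : ∀ i, v i ≤ 2 * e := fun i => by have := hv2 i; linarith
    obtain ⟨τ, hτ, hmv⟩ := local_move (Y v) (Ypos v vpos v2e) (Ysm v vpos v2e).injective d hd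
    obtain ⟨y, hy0, hy1, hy2⟩ := hmv (Y v 0 + s 0 * (min τ d / 2)) (by
      have : 0 < min τ d := lt_min hτ hd
      have h2 := min_le_left τ d
      rw [add_sub_cancel_left, abs_mul, abs_of_pos (half_pos this)]
      rcases hs1 0 with h | h <;> rw [h] <;> simp <;> linarith)
    let v' : Fin (n + 1) → ℝ := fun i => s i * (y i - x i)
    have hY : Y v' = y := by
      funext i
      simp only [Y, v']
      linear_combination (y i - x i) * hss i
    have hmd : 0 < min τ d := lt_min hτ hd
    have hv'0 : v' 0 - v 0 = min τ d / 2 := by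
      rw [← Yd, hY, hy0]
      linear_combination (min τ d / 2) * hss 0
    have hclose : ∀ i, |v' i - v i| < d := by
      intro i
      refine Fin.cases ?_ (fun j => ?_) i
      · rw [hv'0, abs_of_pos (half_pos hmd)]
        have := min_le_right τ d
        linarith
      · rw [← Yd, hY, abs_mul]
        have := hy1 j
        rcases hs1 j.succ with h | h <;> rw [h] <;> simpa using this
    have v'pos : ∀ i, 0 ≤ v' i := fun i => by
      have := (abs_lt.1 (hclose i)).1
      have := hv1 i
      linarith
    have v'lt : ∀ i, v' i ≤ η + e := fun i => by
      have := (abs_lt.1 (hclose i)).2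
      have := hdv i
      linarith
    have v'2e : ∀ i, v' i ≤ 2 * e := fun i => by have := v'lt i; linarith
    have alt := alt_all hn (Ym v' v'pos v'2e) (Ym v (fun i => (vpos i).le) v2e)
      (Y0 v' v'pos v'2e) (Y0 v (fun i => (vpos i).le) v2e) (by rw [hY]; exact hy2)
      hσ (by
        have := Yd v' v 0
        simp only [hs, Fin.val_zero, pow_zero, mul_one] at this
        rw [this, hv'0]; exact half_pos hmd)
    have hgt : ∀ i, v i < v' i := by
      intro i
      have h1 := alt i
      have h2 := Yd v' v i
      simp only [hs] at h2
      rw [h2] at h1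
      linarith
    have hmem : v' ∈ S := ⟨⟨fun i => (hv1 i).trans (hgt i).le, v'lt⟩, fun m hm => by
      rw [hY, hy2 m hm, hv.2 m hm]⟩
    have := hmax hmem
    simp only [Set.mem_ofPred_eq] at this
    have := hgt 0
    linarith
  let T : Set (ℝ × (Fin (n + 1) → ℝ)) := (Set.Icc 0 e ×ˢ Set.Icc (fun _ => 0) (fun _ => 2 * e)) ∩
    ({p | ∀ i, p.1 ≤ p.2 i} ∩ {p | ∀ i, p.2 i ≤ p.1 + e} ∩
     {p | ∀ m < n, PS (Y p.2) m = PS (Y fun _ => p.1) m} ∩ {p | ∏ i, (p.2 i - p.1 - e) = 0})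
  have hTc : IsCompact T := by
    apply (isCompact_Icc.prod isCompact_Icc).inter_right
    refine ((IsClosed.inter ?_ ?_).inter ?_).inter ?_
    · simp only [Set.ofPred_forall]
      exact isClosed_iInter fun i => isClosed_le (by fun_prop) (by fun_prop)
    · simp only [Set.ofPred_forall]
      exact isClosed_iInter fun i => isClosed_le (by fun_prop) (by fun_prop)
    · simp only [Set.ofPred_forall]
      refine isClosed_iInter fun m => isClosed_iInter fun _ => isClosed_eq ?_ ?_
      · exact (PS_continuous m).comp (Yc.comp continuous_snd)
      · exact (PS_continuous m).comp (Yc.comp (by fun_prop))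
    · exact isClosed_eq (by fun_prop) continuous_const
  have hsub : Set.Ioc 0 e ⊆ Prod.fst '' T := by
    rintro η ⟨h1, h2⟩
    obtain ⟨v, a, b, c, d⟩ := stepA η h1 h2
    exact ⟨(η, v), ⟨⟨⟨h1.le, h2⟩, fun i => h1.le.trans (a i), fun i => by
      have := b i; simp only; linarith⟩, ⟨⟨a, b⟩, c⟩, d⟩, rfl⟩
  have h0 : (0 : ℝ) ∈ Prod.fst '' T := by
    have hcl : IsClosed (Prod.fst '' T) := (hTc.image continuous_fst).isClosed
    have := closure_minimal hsub hcl
    rw [closure_Ioc he.ne] at this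
    exact this ⟨le_rfl, he.le⟩
  obtain ⟨⟨η, v⟩, ⟨-, ⟨⟨a, b⟩, c⟩, d⟩, hη⟩ := h0
  simp only at hη
  subst hη
  simp only [Set.mem_ofPred_eq, zero_add, sub_zero] at a b c d
  obtain ⟨i, -, hi⟩ := Finset.prod_eq_zero_iff.1 d
  have Yz : (Y fun _ => 0) = x := by funext i; simp [Y]
  rw [Yz] at c
  have v2e : ∀ i, v i ≤ 2 * e := fun i => by have := b i; linarith
  have hd : ∀ i, s i * (Y v i - x i) = v i := by
    intro i
    have := Yd v (fun _ => 0) i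
    rw [Yz] at this
    simpa using this
  have hne : Y v ≠ x := by
    intro h
    have := hd i
    rw [h] at this
    simp at this
    linarith
  have hf := first_ne hn (Ym v a v2e) hmono (Y0 v a v2e) hx0 c hne
  have hv0 : 0 < v 0 := by
    refine lt_of_le_of_ne (a 0) fun h => hf ?_
    simp [Y, ← h]
  have alt := alt_all hn (Ym v a v2e) hmono (Y0 v a v2e) hx0 c hσ (by
        have := hd 0
        simp only [hs, Fin.val_zero, pow_zero, mul_one] at this
        rw [this]; exact hv0)
  have vpos : ∀ i, 0 < v i := fun i => by rw [← hd i]; exact alt i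
  refine ⟨Y v, c, alt, fun i => ?_, Ypos v vpos v2e, Ysm v vpos v2e⟩
  have e1 : |Y v i - x i| = v i := by
    have e2 : |s i * (Y v i - x i)| = v i := by rw [hd i, abs_of_pos (vpos i)]
    rw [← e2, abs_mul]
    rcases hs1 i with h | h <;> rw [h] <;> simp
  rw [e1]
  exact (b i).trans_lt heε

/-- an alternating pattern of possible moves (`+1` is up, `-1` is down) -/
structure Pat {K : ℕ} (x : Fin K → ℝ) (σ : ℝ) (L z : ℕ) (t : ℕ → Fin K) : Prop where
  inc : ∀ m, m + 1 < L → t m < t (m + 1)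
  gap : ∀ m, m + 1 < L → 0 < σ * (-1) ^ m → x (t m) < x (t (m + 1))
  pos : ∀ m, m < L → σ * (-1) ^ m < 0 → 0 < x (t m)
  low : ∀ m, m < L → z ≤ (t m : ℕ)

lemma inc_lt {K L : ℕ} {t : ℕ → Fin K} (h : ∀ m, m + 1 < L → t m < t (m + 1)) :
    ∀ m m', m < m' → m' < L → t m < t m' := by
  intro m m' hm
  induction m', hm using Nat.le_induction with
  | base => intro h'; exact h m h'
  | succ k hk ih => intro h'; exact (ih (by omega)).trans (h k h')

lemma move {n K z : ℕ} (hn : 1 ≤ n) {x : Fin K → ℝ} (hm : Monotone x) (hx0 : ∀ i, 0 ≤ x i)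
    {σ : ℝ} (hσ : σ = 1 ∨ σ = -1) {t : ℕ → Fin K} (hp : Pat x σ (n + 1) z t) (ε : ℝ)
    (hε : 0 < ε) :
    ∃ y : Fin K → ℝ, (∀ i, 0 ≤ y i) ∧ (∀ m < n, PS y m = PS x m) ∧
      (∀ i, (∀ m ≤ n, t m ≠ i) → y i = x i) ∧
      (∀ m ≤ n, 0 < σ * (-1) ^ m * (y (t m) - x (t m))) ∧
      (∀ i, |y i - x i| < ε) ∧ (∀ m ≤ n, 0 < y (t m)) ∧
      (∀ m m', m < m' → m' ≤ n → y (t m) < y (t m')) := by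
  classical
  let T : Fin (n + 1) → Fin K := fun i => t i
  have hT : StrictMono T := fun i j hij => inc_lt hp.inc i j hij j.2
  obtain ⟨w, h1, h2, h3, h4, h5⟩ := core hn (x ∘ T) σ hσ (hm.comp hT.monotone) (fun i => hx0 _)
    (fun i hi => hp.gap i (by omega) hi) (fun i hi => hp.pos i i.2 hi) ε hε
  let y := Function.extend T w x
  have yT : ∀ i, y (T i) = w i := fun i => hT.injective.extend_apply _ _ _
  have yt : ∀ m (hm : m ≤ n), y (t m) = w ⟨m, by omega⟩ := fun m hm => yT ⟨m, by omega⟩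
  have yn : ∀ i, (¬ ∃ j, T j = i) → y i = x i := fun i hi => Function.extend_apply' _ _ _ hi
  refine ⟨y, fun i => ?_, fun m hm => ?_, fun i hi => ?_, fun m hm => ?_, fun i => ?_,
    fun m hm => ?_, fun m m' hmm hm' => ?_⟩
  · by_cases hi : ∃ j, T j = i
    · obtain ⟨j, rfl⟩ := hi
      rw [yT]; exact (h4 j).le
    · rw [yn i hi]; exact hx0 i
  · have e : ∑ i, (y i ^ (2 * m + 3) - x i ^ (2 * m + 3)) =
        ∑ j, (w j ^ (2 * m + 3) - x (T j) ^ (2 * m + 3)) := by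
      rw [← Finset.sum_subset (Finset.subset_univ (Finset.univ.image T))]
      · rw [Finset.sum_image (fun i _ j _ h => hT.injective h)]
        exact Finset.sum_congr rfl fun j _ => by rw [yT]
      · intro i _ hi
        rw [yn i, sub_self]
        simpa using hi
    have e2 := h1 m hm
    unfold PS at e2 ⊢
    rw [Finset.sum_sub_distrib, Finset.sum_sub_distrib, e2] at e
    simp only [Function.comp] at e
    linarith
  · apply yn
    rintro ⟨j, hj⟩
    exact hi j (by omega) hj
  · rw [yt m hm]; exact h2 ⟨m, by omega⟩
  · by_cases hi : ∃ j, T j = i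
    · obtain ⟨j, rfl⟩ := hi
      rw [yT]; exact h3 j
    · rw [yn i hi, sub_self, abs_zero]; exact hε
  · rw [yt m hm]; exact h4 _
  · rw [yt m (by omega), yt m' hm']
    exact h5 (by simpa using hmm)

lemma sgn_cases {σ : ℝ} (hσ : σ = 1 ∨ σ = -1) (k : ℕ) :
    σ * (-1) ^ k = 1 ∨ σ * (-1) ^ k = -1 := by
  rcases hσ with h | h <;> rcases neg_one_pow_eq_or ℝ k with h' | h' <;> simp [h, h']

lemma spliceA {n K z : ℕ} {x : Fin K → ℝ} (hm : Monotone x) {σ : ℝ}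
    {i j : ℕ → Fin K} (hi : Pat x σ n z i) (hj : Pat x (-σ) n z j) (k : ℕ) (hk : k < n)
    (hu : σ * (-1) ^ k = 1) :
    i k = j k ∨ ∃ t, Pat x σ (n + 1) z t ∨ Pat x (-σ) (n + 1) z t := by
  have splice : ∀ (τ : ℝ) (p q : ℕ → Fin K), Pat x τ n z p → Pat x (-τ) n z q → p k < q k →
      (0 < τ * (-1) ^ k → x (p k) < x (q k)) →
      Pat x τ (n + 1) z (fun m => if m ≤ k then p m else q (m - 1)) := by
    intro τ p q hp hq hlt hg
    refine ⟨fun m hm => ?_, fun m hm hs => ?_, fun m hm hs => ?_, fun m hm => ?_⟩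
    · rcases lt_trichotomy m k with h | h | h
      · simp only [if_pos h.le, if_pos (show m + 1 ≤ k by omega)]
        exact hp.inc m (by omega)
      · subst h
        simpa using hlt
      · obtain ⟨m, rfl⟩ : ∃ l, m = l + 1 := ⟨m - 1, by omega⟩
        simp only [if_neg (show ¬ m + 1 ≤ k by omega), if_neg (show ¬ m + 1 + 1 ≤ k by omega)]
        exact hq.inc m (by omega)
    · rcases lt_trichotomy m k with h | h | h
      · simp only [if_pos h.le, if_pos (show m + 1 ≤ k by omega)]
        exact hp.gap m (by omega) hs
      · subst h
        simpa using hg hs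
      · obtain ⟨m, rfl⟩ : ∃ l, m = l + 1 := ⟨m - 1, by omega⟩
        simp only [if_neg (show ¬ m + 1 ≤ k by omega), if_neg (show ¬ m + 1 + 1 ≤ k by omega)]
        exact hq.gap m (by omega) (by rw [pow_succ] at hs; linarith)
    · by_cases h : m ≤ k
      · simp only [if_pos h]
        exact hp.pos m (by omega) hs
      · obtain ⟨m, rfl⟩ : ∃ l, m = l + 1 := ⟨m - 1, by omega⟩
        simp only [if_neg h]
        exact hq.pos m (by omega) (by rw [pow_succ] at hs; linarith)
    · split_ifs with h
      · exact hp.low m (by omega)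
      · exact hq.low _ (by omega)
  rcases lt_trichotomy (i k) (j k) with h | h | h
  · right
    by_cases hx : x (i k) < x (j k)
    · exact ⟨_, Or.inl (splice σ i j hi hj h fun _ => hx)⟩
    · have hxe : x (i k) = x (j k) := le_antisymm (hm h.le) (not_lt.1 hx)
      have hposk : 0 < x (j k) := hj.pos k hk (by linarith)
      refine ⟨fun m => if m < k then j m else if m = k then i k else if m = k + 1 then j k
        else i (m - 1), Or.inr ⟨fun m hm' => ?_, fun m hm' hs => ?_, fun m hm hs => ?_,
          fun m hm => ?_⟩⟩
      · by_cases h1 : m + 1 < k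
        · simp only [if_pos h1, if_pos (show m < k by omega)]
          exact hj.inc m (by omega)
        by_cases h2 : m + 1 = k
        · subst h2
          have hg := hj.gap m hk (by rw [pow_succ] at hu; linarith)
          have : j m < i (m + 1) := by
            by_contra hh
            have := hm (not_lt.1 hh)
            linarith
          simpa using this
        by_cases h3 : m = k
        · subst h3
          simpa using h
        by_cases h4 : m = k + 1
        · subst h4
          have hg := hi.gap k (by omega) (by linarith)
          have : j k < i (k + 1) := by
            by_contra hh
            have := hm (not_lt.1 hh)
            linarith
          simpa [show ¬ k + 1 + 1 < k by omega, show ¬ k + 1 + 1 = k by omega] using this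
        · obtain ⟨m, rfl⟩ : ∃ l, m = l + 1 := ⟨m - 1, by omega⟩
          simp only [if_neg (show ¬ m + 1 < k by omega), if_neg (show ¬ m + 1 = k by omega),
            if_neg (show ¬ m + 1 = k + 1 by omega), if_neg (show ¬ m + 1 + 1 < k by omega),
            if_neg (show ¬ m + 1 + 1 = k by omega), if_neg (show ¬ m + 1 + 1 = k + 1 by omega)]
          exact hi.inc m (by omega)
      · by_cases h1 : m + 1 < k
        · simp only [if_pos h1, if_pos (show m < k by omega)]
          exact hj.gap m (by omega) hs
        by_cases h2 : m + 1 = k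
        · subst h2
          have hg := hj.gap m hk hs
          rw [← hxe] at hg
          simpa using hg
        by_cases h3 : m = k
        · subst h3
          linarith
        by_cases h4 : m = k + 1
        · subst h4
          have hg := hi.gap k (by omega) (by linarith)
          rw [hxe] at hg
          simpa [show ¬ k + 1 + 1 < k by omega, show ¬ k + 1 + 1 = k by omega] using hg
        · obtain ⟨m, rfl⟩ : ∃ l, m = l + 1 := ⟨m - 1, by omega⟩
          simp only [if_neg (show ¬ m + 1 < k by omega), if_neg (show ¬ m + 1 = k by omega),
            if_neg (show ¬ m + 1 = k + 1 by omega), if_neg (show ¬ m + 1 + 1 < k by omega),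
            if_neg (show ¬ m + 1 + 1 = k by omega), if_neg (show ¬ m + 1 + 1 = k + 1 by omega)]
          exact hi.gap m (by omega) (by rw [pow_succ] at hs; linarith)
      · by_cases h1 : m < k
        · simp only [if_pos h1]
          exact hj.pos m (by omega) hs
        by_cases h3 : m = k
        · subst h3
          simpa [hxe] using hposk
        by_cases h4 : m = k + 1
        · subst h4
          simpa using hposk
        · obtain ⟨m, rfl⟩ : ∃ l, m = l + 1 := ⟨m - 1, by omega⟩
          simp only [if_neg h1, if_neg h3, if_neg h4]
          exact hi.pos m (by omega) (by rw [pow_succ] at hs; linarith)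
      · split_ifs
        · exact hj.low m (by omega)
        · exact hi.low k hk
        · exact hj.low k hk
        · exact hi.low _ (by omega)
  · exact Or.inl h
  · right
    refine ⟨_, Or.inr (splice (-σ) j i hj (by rwa [neg_neg]) h fun h' => ?_)⟩
    linarith

lemma combine {n K z : ℕ} {x : Fin K → ℝ} (hm : Monotone x)
    {i j : ℕ → Fin K} (hi : Pat x 1 n z i) (hj : Pat x (-1) n z j) :
    (∃ σ : ℝ, (σ = 1 ∨ σ = -1) ∧ ∃ t, Pat x σ (n + 1) z t) ∨
    ∃ R : Finset (Fin K), n ≤ R.card ∧ Set.InjOn x R ∧ ∀ r ∈ R, 0 < x r := by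
  classical
  by_cases hno : ∃ σ : ℝ, (σ = 1 ∨ σ = -1) ∧ ∃ t, Pat x σ (n + 1) z t
  · exact Or.inl hno
  right
  have heq : ∀ k < n, i k = j k := by
    intro k hk
    rcases neg_one_pow_eq_or ℝ k with h | h
    · rcases spliceA hm hi hj k hk (by rw [h]; norm_num) with h' | ⟨t, h' | h'⟩
      · exact h'
      · exact absurd ⟨_, by norm_num, t, h'⟩ hno
      · exact absurd ⟨_, by norm_num, t, h'⟩ hno
    · rcases spliceA hm hj (by rwa [neg_neg]) k hk (by rw [h]; norm_num) with h' | ⟨t, h' | h'⟩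
      · exact h'.symm
      · exact absurd ⟨_, by norm_num, t, h'⟩ hno
      · exact absurd ⟨_, by norm_num, t, h'⟩ hno
  have hlt : ∀ m, m + 1 < n → x (i m) < x (i (m + 1)) := by
    intro m hm
    rcases neg_one_pow_eq_or ℝ m with h | h
    · exact hi.gap m hm (by rw [h]; norm_num)
    · rw [heq m (by omega), heq (m + 1) hm]
      exact hj.gap m hm (by rw [h]; norm_num)
  have hlt2 : ∀ m m', m < m' → m' < n → x (i m) < x (i m') := by
    intro m m' h
    induction m', h using Nat.le_induction with
    | base => intro h'; exact hlt m h'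
    | succ k hk ih => intro h'; exact (ih (by omega)).trans (hlt k h')
  have hinj : ∀ m < n, ∀ m' < n, x (i m) = x (i m') → m = m' := by
    intro m h m' h' he
    rcases lt_trichotomy m m' with h1 | h1 | h1
    · have := hlt2 m m' h1 h'; linarith
    · exact h1
    · have := hlt2 m' m h1 h; linarith
  refine ⟨(Finset.range n).image i, ?_, ?_, ?_⟩
  · rw [Finset.card_image_of_injOn, Finset.card_range]
    intro m h m' h' he
    exact hinj m (by simpa using h) m' (by simpa using h') (by rw [he])
  · intro a ha b hb hab
    simp only [Finset.coe_image, Set.mem_image, Finset.coe_range, Set.mem_Iio] at ha hb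
    obtain ⟨m, h, rfl⟩ := ha
    obtain ⟨m', h', rfl⟩ := hb
    rw [hinj m h m' h' hab]
  · intro r hr
    simp only [Finset.mem_image, Finset.mem_range] at hr
    obtain ⟨m, h, rfl⟩ := hr
    have p0 : 0 < x (i 0) := by
      rw [heq 0 (by omega)]
      exact hj.pos 0 (by omega) (by norm_num)
    rcases Nat.eq_zero_or_pos m with rfl | h0
    · exact p0
    · exact p0.trans (hlt2 0 m h0 h)

lemma zero_of_card {K N : ℕ} {x : Fin K → ℝ} (hm : Monotone x) (h0 : ∀ i, 0 ≤ x i)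
    (hc : (Finset.univ.filter (fun i => x i ≠ 0)).card ≤ N) (i : Fin K) (hi : (i : ℕ) + N < K) :
    x i = 0 := by
  by_contra h
  have hpos : 0 < x i := lt_of_le_of_ne (h0 i) (Ne.symm h)
  have hs : Finset.Ici i ⊆ Finset.univ.filter (fun i => x i ≠ 0) := by
    intro j hj
    simp only [Finset.mem_filter, Finset.mem_univ, true_and]
    exact (hpos.trans_le (hm (Finset.mem_Ici.1 hj))).ne'
  have := Finset.card_le_card hs
  rw [Fin.card_Ici] at this
  omega

lemma card_of_zero {K N : ℕ} {x : Fin K → ℝ} (h : ∀ i : Fin K, (i : ℕ) + N < K → x i = 0) :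
    (Finset.univ.filter (fun i => x i ≠ 0)).card ≤ N := by
  by_cases hK : K ≤ N
  · exact (Finset.card_le_univ _).trans (by simpa using hK)
  · by_cases hN : N = 0
    · subst hN
      rw [Finset.filter_false_of_mem]
      · simp
      · intro i _
        simpa using h i (by simp)
    have hs : Finset.univ.filter (fun i => x i ≠ 0) ⊆ Finset.Ici (⟨K - N, by omega⟩ : Fin K) := by
      intro j hj
      simp only [Finset.mem_filter, Finset.mem_univ, true_and] at hj
      rw [Finset.mem_Ici, Fin.le_def]
      by_contra hh
      exact hj (h j (by simp only at hh; omega))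
    have := Finset.card_le_card hs
    rw [Fin.card_Ici] at this
    simp only at this
    omega

lemma PS_perm {K : ℕ} (x : Fin K → ℝ) (e : Equiv.Perm (Fin K)) (m : ℕ) :
    PS (x ∘ e) m = PS x m := by
  unfold PS
  exact Equiv.sum_comp e (fun i => x i ^ (2 * m + 3))

lemma card_perm {K : ℕ} (x : Fin K → ℝ) (e : Equiv.Perm (Fin K)) :
    (Finset.univ.filter (fun i => (x ∘ e) i ≠ 0)).card ≤
      (Finset.univ.filter (fun i => x i ≠ 0)).card := by
  apply Finset.card_le_card_of_injOn e
  · intro i hi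
    simpa using hi
  · exact e.injective.injOn

lemma sort_coord {K : ℕ} (y : Fin K → ℝ) (z : Fin K) (h : ∀ i < z, y i ≤ y z) :
    (y ∘ Tuple.sort y) z ≤ y z := by
  by_contra! hlt
  have hmono := Tuple.monotone_sort y
  have h1 : (Finset.Iic z).card ≤ (Finset.Iio z).card := by
    apply Finset.card_le_card_of_injOn (Tuple.sort y).symm
    · intro i hi
      simp only [Finset.coe_Iic, Set.mem_Iic, Finset.coe_Iio, Set.mem_Iio] at hi ⊢
      by_contra! hh
      have h2 := hmono hh
      have h3 : y i ≤ y z := by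
        rcases hi.lt_or_eq with h' | h'
        · exact h i h'
        · rw [h']
      simp only [Function.comp, Equiv.apply_symm_apply] at h2 hlt
      linarith
    · exact (Equiv.injective _).injOn
  rw [Fin.card_Iic, Fin.card_Iio] at h1
  omega

lemma cmp_up {n K z : ℕ} (hn : 1 ≤ n) {x γ : Fin K → ℝ} (hx : Monotone x) (hγ : Monotone γ)
    (hx0 : ∀ i, 0 ≤ x i) (hγ0 : ∀ i, 0 ≤ γ i)
    (h : ∀ m < n, (-1 : ℝ) ^ m * PS x m ≤ (-1) ^ m * PS γ m) (hne : x ≠ γ)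
    (hz : ∀ i : Fin K, (i : ℕ) < z → γ i = 0) : ∃ t, Pat x 1 n z t := by
  obtain ⟨t, ht, hs⟩ := compare hn hx hγ hx0 hγ0 h hne
  have ht0 : z ≤ (t 0 : ℕ) := by
    by_contra! hh
    have h1 := hs 0 (by omega)
    have h2 := hz _ hh
    have h3 := hx0 (t 0)
    rw [h2, pow_zero] at h1
    linarith
  refine ⟨t, ht, fun m hm hσ => ?_, fun m hm hσ => ?_, fun m hm => ?_⟩
  · have h1 := hs m (by omega)
    have h2 := hs (m + 1) hm
    have h3 := hγ (ht m hm).le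
    rcases neg_one_pow_eq_or ℝ m with h' | h' <;> rw [pow_succ, h'] at h2 <;>
      rw [h'] at h1 hσ <;> linarith
  · have h1 := hs m hm
    have h3 := hγ0 (t m)
    rcases neg_one_pow_eq_or ℝ m with h' | h' <;> rw [h'] at h1 hσ <;> linarith
  · rcases Nat.eq_zero_or_pos m with rfl | h0
    · exact ht0
    · have := inc_lt ht 0 m h0 hm
      rw [Fin.lt_def] at this
      omega

lemma cmp_down {n K z : ℕ} (hn : 1 ≤ n) {x β : Fin K → ℝ} (hx : Monotone x) (hβ : Monotone β)
    (hx0 : ∀ i, 0 ≤ x i) (hβ0 : ∀ i, 0 ≤ β i)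
    (h : ∀ m < n, (-1 : ℝ) ^ m * PS β m ≤ (-1) ^ m * PS x m) (hne : β ≠ x)
    (hz : ∀ i : Fin K, (i : ℕ) < z → x i = 0) : ∃ t, Pat x (-1) n z t := by
  obtain ⟨t, ht, hs⟩ := compare hn hβ hx hβ0 hx0 h hne
  have ht0 : z ≤ (t 0 : ℕ) := by
    by_contra! hh
    have h1 := hs 0 (by omega)
    have h2 := hz _ hh
    have h3 := hβ0 (t 0)
    rw [h2, pow_zero] at h1
    linarith
  refine ⟨t, ht, fun m hm hσ => ?_, fun m hm hσ => ?_, fun m hm => ?_⟩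
  · have h1 := hs m (by omega)
    have h2 := hs (m + 1) hm
    have h3 := hβ (ht m hm).le
    rcases neg_one_pow_eq_or ℝ m with h' | h' <;> rw [pow_succ, h'] at h2 <;>
      rw [h'] at h1 hσ <;> linarith
  · have h1 := hs m hm
    have h3 := hβ0 (t m)
    rcases neg_one_pow_eq_or ℝ m with h' | h' <;> rw [h'] at h1 hσ <;> linarith
  · rcases Nat.eq_zero_or_pos m with rfl | h0
    · exact ht0
    · have := inc_lt ht 0 m h0 hm
      rw [Fin.lt_def] at this
      omega

/-- prepend an index -/
def consT {K : ℕ} (z : Fin K) (t : ℕ → Fin K) : ℕ → Fin K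
  | 0 => z
  | m + 1 => t m

lemma prepend {n K : ℕ} {x : Fin K → ℝ} {z : Fin K} {t : ℕ → Fin K}
    (hp : Pat x 1 n (z + 1) t) (hz : 0 < x z) : Pat x (-1) (n + 1) z (consT z t) := by
  refine ⟨fun m hm => ?_, fun m hm hσ => ?_, fun m hm hσ => ?_, fun m hm => ?_⟩
  · rcases m with _ | m
    · have := hp.low 0 (by omega)
      change z < t 0
      rw [Fin.lt_def]
      omega
    · exact hp.inc m (by omega)
  · rcases m with _ | m
    · norm_num at hσ
    · exact hp.gap m (by omega) (by rw [pow_succ] at hσ; linarith)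
  · rcases m with _ | m
    · exact hz
    · exact hp.pos m (by omega) (by rw [pow_succ] at hσ; linarith)
  · rcases m with _ | m
    · exact le_rfl
    · have := hp.low m (by omega)
      change (z : ℕ) ≤ t m
      omega

lemma descend {n K N N' : ℕ} (hn : 1 ≤ n) (hNN : N ≤ N') (E : ℕ → ℝ) {γ : Fin K → ℝ}
    (hγ : Monotone γ) (hγ0 : ∀ i, 0 ≤ γ i) (hγz : ∀ i : Fin K, (i : ℕ) + N < K → γ i = 0)
    (hle : ∀ m < n, (-1 : ℝ) ^ m * E m ≤ (-1) ^ m * PS γ m)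
    (hx : ∃ x : Fin K → ℝ, (∀ i, 0 ≤ x i) ∧ (∀ m < n, PS x m = E m) ∧
      (Finset.univ.filter (fun i => x i ≠ 0)).card ≤ N' + 1) :
    ∃ x : Fin K → ℝ, (∀ i, 0 ≤ x i) ∧ (∀ m < n, PS x m = E m) ∧
      (Finset.univ.filter (fun i => x i ≠ 0)).card ≤ N' := by
  obtain ⟨x, hx0, hxE, hxc⟩ := hx
  by_cases hK : K ≤ N'
  · exact ⟨x, hx0, hxE, (Finset.card_le_univ _).trans (by simpa using hK)⟩
  let z : Fin K := ⟨K - (N' + 1), by omega⟩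
  let S : Set (Fin K → ℝ) := {y | (∀ i j, i ≤ j → y i ≤ y j) ∧ (∀ i, 0 ≤ y i) ∧
    (∀ m, m < n → PS y m = E m) ∧ ∀ i : Fin K, (i : ℕ) + (N' + 1) < K → y i = 0}
  have into : ∀ y : Fin K → ℝ, (∀ i, 0 ≤ y i) → (∀ m < n, PS y m = E m) →
      (Finset.univ.filter (fun i => y i ≠ 0)).card ≤ N' + 1 → y ∘ Tuple.sort y ∈ S := by
    intro y h0 hE hc
    have hm := Tuple.monotone_sort y
    refine ⟨fun i j hij => hm hij, fun i => h0 _, fun m hm => ?_, ?_⟩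
    · rw [PS_perm, hE m hm]
    · exact zero_of_card hm (fun i => h0 _) ((card_perm y _).trans hc)
  have hclosed : IsClosed S := by
    simp only [S, Set.ofPred_and, Set.ofPred_forall]
    refine IsClosed.inter ?_ (IsClosed.inter ?_ (IsClosed.inter ?_ ?_))
    · exact isClosed_iInter fun i => isClosed_iInter fun j => isClosed_iInter fun _ =>
        isClosed_le (continuous_apply i) (continuous_apply j)
    · exact isClosed_iInter fun i => isClosed_le continuous_const (continuous_apply i)
    · exact isClosed_iInter fun m => isClosed_iInter fun _ =>
        isClosed_eq (PS_continuous m) continuous_const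
    · exact isClosed_iInter fun i => isClosed_iInter fun _ =>
        isClosed_eq (continuous_apply i) continuous_const
  have hcomp : IsCompact S := by
    refine IsCompact.of_isClosed_subset (isCompact_Icc (a := (0 : Fin K → ℝ))
      (b := fun _ => max 1 (E 0))) hclosed ?_
    rintro y ⟨_, h0, hE, _⟩
    refine ⟨fun i => h0 i, fun i => ?_⟩
    have h1 : y i ^ 3 ≤ E 0 := by
      rw [← hE 0 (by omega)]
      exact Finset.single_le_sum (f := fun i => y i ^ (2 * 0 + 3))
        (fun j _ => pow_nonneg (h0 j) _) (Finset.mem_univ i)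
    by_cases h2 : y i ≤ 1
    · exact h2.trans (le_max_left _ _)
    · refine le_trans ?_ (le_max_right _ _)
      have h3 : 1 ≤ y i := (not_le.1 h2).le
      have h4 : y i ≤ y i ^ 3 := le_self_pow₀ h3 (by norm_num)
      linarith
  obtain ⟨δ, hδS, hmin⟩ := hcomp.exists_isMinOn ⟨_, into x hx0 hxE hxc⟩
    (continuous_apply z).continuousOn
  obtain ⟨hδm', hδ0, hδE, hδz⟩ := hδS
  have hδm : Monotone δ := fun i j h => hδm' i j h
  by_cases hz0 : δ z = 0
  · refine ⟨δ, hδ0, hδE, card_of_zero fun i hi => ?_⟩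
    have h1 : i ≤ z := by rw [Fin.le_def]; change (i : ℕ) ≤ K - (N' + 1); omega
    have := hδm h1
    exact le_antisymm (by linarith) (hδ0 i)
  exfalso
  have hzpos : 0 < δ z := lt_of_le_of_ne (hδ0 z) (Ne.symm hz0)
  have hzv : (z : ℕ) = K - (N' + 1) := rfl
  have hne : δ ≠ γ := by
    rintro rfl
    exact hz0 (hγz z (by omega))
  obtain ⟨t, ht⟩ := cmp_up (z := z + 1) hn hδm hγ hδ0 hγ0
    (fun m hm => by rw [hδE m hm]; exact hle m hm) hne (fun i hi => hγz i (by omega))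
  have hp := prepend ht hzpos
  obtain ⟨y, hy0, hyE, hyn, hys, -, -, -⟩ := move hn hδm hδ0 (Or.inr rfl) hp 1 one_pos
  have hyz : ∀ i < z, y i = 0 := by
    intro i hi
    rw [hyn i]
    · exact hδz i (by rw [Fin.lt_def] at hi; omega)
    · rintro m hm rfl
      have := hp.low m (by omega)
      rw [Fin.lt_def] at hi
      omega
  have hylt : y z < δ z := by
    have := hys 0 (by omega)
    change 0 < -1 * (-1) ^ 0 * (y z - δ z) at this
    rw [pow_zero] at this
    linarith
  have hin := into y hy0 (fun m hm => by rw [hyE m hm, hδE m hm])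
    (card_of_zero fun i hi => hyz i (by rw [Fin.lt_def]; omega))
  have h1 : δ z ≤ (y ∘ Tuple.sort y) z := hmin hin
  have h2 := sort_coord y z (fun i hi => by rw [hyz i hi]; exact hy0 z)
  linarith

lemma finish {K N : ℕ} {x : Fin K → ℝ} (hx0 : ∀ i, 0 ≤ x i)
    (hc : (Finset.univ.filter (fun i => x i ≠ 0)).card ≤ N) (hinj : Set.InjOn x {i | 0 < x i}) :
    ∃ M ≤ N, ∃ δ : Fin M → ℝ, Function.Injective δ ∧ (∀ j, 0 < δ j) ∧
      ∀ m, PS δ m = PS x m := by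
  set F := Finset.univ.filter (fun i => x i ≠ 0) with hF
  have hFp : ∀ i : F, 0 < x i := by
    intro i
    have := (Finset.mem_filter.1 i.2).2
    exact lt_of_le_of_ne (hx0 _) this.symm
  refine ⟨F.card, hc, fun j => x (F.equivFin.symm j), ?_, fun j => hFp _, fun m => ?_⟩
  · intro j j' h
    have := hinj (hFp _) (hFp _) h
    exact F.equivFin.symm.injective (Subtype.ext this)
  · unfold PS
    rw [Equiv.sum_comp F.equivFin.symm (fun i : F => x i ^ (2 * m + 3)),
      Finset.sum_coe_sort F (fun i => x i ^ (2 * m + 3))]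
    apply Finset.sum_subset (Finset.subset_univ _)
    intro i _ hi
    have : x i = 0 := by simpa [hF] using hi
    rw [this, zero_pow (by omega)]

lemma small {K : ℕ} (x : Fin K → ℝ) : ∃ ε > 0, (∀ i j, x i < x j → x i + 2 * ε < x j) ∧
    ∀ i, 0 < x i → ε < x i := by
  have h1 : ∀ i j, ∀ᶠ ε : ℝ in nhdsWithin 0 (Set.Ioi 0), x i < x j → x i + 2 * ε < x j := by
    intro i j
    by_cases h : x i < x j
    · have : Filter.Tendsto (fun ε : ℝ => x i + 2 * ε) (nhdsWithin 0 (Set.Ioi 0)) (nhds (x i)) := by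
        have : Continuous (fun ε : ℝ => x i + 2 * ε) := by fun_prop
        have := this.tendsto 0
        simp only [mul_zero, add_zero] at this
        exact this.mono_left nhdsWithin_le_nhds
      filter_upwards [this.eventually_lt_const h] with ε hε _ using hε
    · exact Filter.Eventually.of_forall fun ε h' => absurd h' h
  have h2 : ∀ i, ∀ᶠ ε : ℝ in nhdsWithin 0 (Set.Ioi 0), 0 < x i → ε < x i := by
    intro i
    by_cases h : 0 < x i
    · filter_upwards [Ioo_mem_nhdsGT h] with ε hε _ using hε.2
    · exact Filter.Eventually.of_forall fun ε h' => absurd h' h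
  have h3 := (Filter.eventually_all.2 fun i => Filter.eventually_all.2 fun j => h1 i j).and
    ((Filter.eventually_all.2 h2).and self_mem_nhdsWithin)
  obtain ⟨ε, h, h', h''⟩ := h3.exists
  exact ⟨ε, h'', h, h'⟩

lemma keep_zero {n K N : ℕ} {x y : Fin K → ℝ} {σ : ℝ} {t : ℕ → Fin K}
    (hp : Pat x σ (n + 1) (K - N) t) (hxz : ∀ i : Fin K, (i : ℕ) + N < K → x i = 0)
    (hyn : ∀ i, (∀ m ≤ n, t m ≠ i) → y i = x i) : ∀ i : Fin K, (i : ℕ) + N < K → y i = 0 := by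
  intro i hi
  rw [hyn i]
  · exact hxz i hi
  · rintro m hm rfl
    have := hp.low m (by omega)
    omega

lemma step_big {n K N : ℕ} (hn : 1 ≤ n) {x : Fin K → ℝ} (hx : Monotone x) (hx0 : ∀ i, 0 ≤ x i)
    (hxz : ∀ i : Fin K, (i : ℕ) + N < K → x i = 0) (R : Finset (Fin K)) (hR : Set.InjOn x R)
    (hRp : ∀ r ∈ R, 0 < x r) (hcard : n ≤ R.card) (a b : Fin K) (ha : a ∈ R) (hb : b ∉ R)
    (hab : x a = x b) :
    ∃ y : Fin K → ℝ, (∀ i, 0 ≤ y i) ∧ (∀ m < n, PS y m = PS x m) ∧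
      (∀ i : Fin K, (i : ℕ) + N < K → y i = 0) ∧
      ∃ R' : Finset (Fin K), R.card + 1 ≤ R'.card ∧ Set.InjOn y R' ∧ ∀ r ∈ R', 0 < y r := by
  classical
  have key : ∀ p ∈ insert b R, ∀ q ∈ insert b R, p ≠ q → x p = x q →
      (p = a ∧ q = b) ∨ (p = b ∧ q = a) := by
    intro p hp q hq hpq he
    rcases Finset.mem_insert.1 hp with h1 | h1 <;> rcases Finset.mem_insert.1 hq with h2 | h2
    · exact absurd (h1.trans h2.symm) hpq
    · right
      refine ⟨h1, hR h2 ha ?_⟩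
      rw [← he, h1, hab]
    · left
      refine ⟨hR h1 ha ?_, h2⟩
      rw [he, h2, hab]
    · exact absurd (hR h1 h2 he) hpq
  have hpos : ∀ p ∈ insert b R, 0 < x p := by
    intro p hp
    rcases Finset.mem_insert.1 hp with rfl | h1
    · rw [← hab]; exact hRp a ha
    · exact hRp p h1
  have hne : a ≠ b := fun h => hb (h ▸ ha)
  obtain ⟨u, hau, huR, huc⟩ := Finset.exists_subsuperset_card_eq
    (Finset.singleton_subset_iff.2 ha) (by simpa using hn) hcard
  have hau' : a ∈ u := Finset.singleton_subset_iff.1 hau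
  have hbu : b ∉ u := fun h => hb (huR h)
  have hSc : (insert b u).card = n + 1 := by rw [Finset.card_insert_of_notMem hbu, huc]
  let T := (insert b u).orderEmbOfFin hSc
  have hTR : ∀ i, T i ∈ insert b R := fun i =>
    Finset.insert_subset_insert b huR (Finset.orderEmbOfFin_mem _ hSc i)
  let t : ℕ → Fin K := fun m => if h : m < n + 1 then T ⟨m, h⟩ else T 0
  have tT : ∀ m (h : m < n + 1), t m = T ⟨m, h⟩ := fun m h => dif_pos h
  have hsurj : ∀ p ∈ insert b u, ∃ m, m < n + 1 ∧ t m = p := by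
    intro p hp
    have : p ∈ Set.range T := by
      rw [Finset.range_orderEmbOfFin]; exact hp
    obtain ⟨k, hk⟩ := this
    exact ⟨k, k.2, by rw [tT k k.2]; exact hk⟩
  have hinc : ∀ m, m + 1 < n + 1 → t m < t (m + 1) := by
    intro m h
    rw [tT m (by omega), tT (m + 1) h]
    exact T.strictMono (by simp)
  have hmin : min a b ∈ insert b u := by
    rcases min_choice a b with h | h <;> rw [h] <;> simp [hau']
  obtain ⟨k, hk, htk⟩ := hsurj _ hmin
  have htR : ∀ m, m < n + 1 → t m ∈ insert b R := fun m h => by rw [tT m h]; exact hTR _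
  have hp : Pat x (-(-1) ^ k) (n + 1) (K - N) t := by
    refine ⟨hinc, fun m hm hs => ?_, fun m hm _ => hpos _ (htR m hm), fun m hm => ?_⟩
    · by_contra hh
      have hlt := hinc m hm
      have he : x (t m) = x (t (m + 1)) := le_antisymm (hx hlt.le) (not_lt.1 hh)
      have hmk : t m = t k := by
        rw [htk]
        rcases key _ (htR m (by omega)) _ (htR (m + 1) hm) hlt.ne he with ⟨h1, h2⟩ | ⟨h1, h2⟩
        · rw [h1, h2] at hlt; rw [h1, min_eq_left hlt.le]
        · rw [h1, h2] at hlt; rw [h1, min_eq_right hlt.le]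
      have hmk' : m = k := by
        rw [tT m (by omega), tT k hk] at hmk
        simpa using T.injective hmk
      subst hmk'
      rcases neg_one_pow_eq_or ℝ m with h | h <;> rw [h] at hs <;> norm_num at hs
    · by_contra hh
      have h1 := hpos _ (htR m hm)
      rw [hxz (t m) (by omega)] at h1
      exact lt_irrefl _ h1
  have hσ : -(-1 : ℝ) ^ k = 1 ∨ -(-1 : ℝ) ^ k = -1 := by
    rcases neg_one_pow_eq_or ℝ k with h | h <;> rw [h] <;> norm_num
  obtain ⟨ε, hε, hε1, hε2⟩ := small x
  obtain ⟨y, hy0, hyE, hyn, -, hyε, -, hyt⟩ := move hn hx hx0 hσ hp ε hε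
  have hyab : y a ≠ y b := by
    obtain ⟨m, hm, hma⟩ := hsurj a (by simp [hau'])
    obtain ⟨m', hm', hmb⟩ := hsurj b (by simp)
    rw [← hma, ← hmb]
    rcases lt_trichotomy m m' with h | h | h
    · exact (hyt m m' h (by omega)).ne
    · subst h
      exact absurd (hma.symm.trans hmb) hne
    · exact (hyt m' m h (by omega)).ne'
  refine ⟨y, hy0, hyE, keep_zero hp hxz hyn, insert b R, ?_, ?_, ?_⟩
  · rw [Finset.card_insert_of_notMem hb]
  · intro p hp q hq he
    by_contra hpq
    have e1 := abs_lt.1 (hyε p)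
    have e2 := abs_lt.1 (hyε q)
    rcases lt_trichotomy (x p) (x q) with h | h | h
    · have := hε1 p q h
      linarith [e1.1, e1.2, e2.1, e2.2]
    · rcases key p hp q hq hpq h with ⟨rfl, rfl⟩ | ⟨rfl, rfl⟩
      · exact hyab he
      · exact hyab he.symm
    · have := hε1 q p h
      linarith [e1.1, e1.2, e2.1, e2.2]
  · intro p hp
    have := hε2 p (hpos p hp)
    have e1 := abs_lt.1 (hyε p)
    linarith [e1.1]

lemma step {n K N : ℕ} (hn : 1 ≤ n) (hNK : N < K) {x γ β : Fin K → ℝ}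
    (hx : Monotone x) (hx0 : ∀ i, 0 ≤ x i)
    (hxz : ∀ i : Fin K, (i : ℕ) + N < K → x i = 0)
    (hγ : Monotone γ) (hγ0 : ∀ i, 0 ≤ γ i) (hγz : ∀ i : Fin K, (i : ℕ) + N < K → γ i = 0)
    (hle : ∀ m < n, (-1 : ℝ) ^ m * PS x m ≤ (-1) ^ m * PS γ m) (hne : x ≠ γ)
    (hβ : Monotone β) (hβ0 : ∀ i, 0 < β i) (hβE : ∀ m < n, PS β m = PS x m)
    (R : Finset (Fin K)) (hR : Set.InjOn x R)
    (hRp : ∀ r ∈ R, 0 < x r) (hninj : ¬ Set.InjOn x {i | 0 < x i}) :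
    ∃ y : Fin K → ℝ, (∀ i, 0 ≤ y i) ∧ (∀ m < n, PS y m = PS x m) ∧
      (∀ i : Fin K, (i : ℕ) + N < K → y i = 0) ∧
      ∃ R' : Finset (Fin K), R.card + 1 ≤ R'.card ∧ Set.InjOn y R' ∧ ∀ r ∈ R', 0 < y r := by
  classical
  obtain ⟨b, hb, hbp⟩ : ∃ b, b ∉ R ∧ 0 < x b := by
    by_contra! hh
    apply hninj
    intro p hp q hq he
    refine hR ?_ ?_ he
    · by_contra h
      exact absurd (hh p h) (not_le.2 hp)
    · by_contra h
      exact absurd (hh q h) (not_le.2 hq)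
  by_cases hab : ∃ a ∈ R, x a = x b
  · obtain ⟨a, ha, hab⟩ := hab
    by_cases hcard : n ≤ R.card
    · exact step_big hn hx hx0 hxz R hR hRp hcard a b ha hb hab
    obtain ⟨i, hi⟩ := cmp_up (z := K - N) hn hx hγ hx0 hγ0 hle hne
      (fun i hi => hγz i (by omega))
    have hne2 : β ≠ x := by
      rintro rfl
      have h1 := hβ0 ⟨0, by omega⟩
      rw [hxz ⟨0, by omega⟩ (by simpa using hNK)] at h1
      exact lt_irrefl _ h1
    obtain ⟨j, hj⟩ := cmp_down (z := K - N) hn hx hβ hx0 (fun i => (hβ0 i).le)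
      (fun m hm => by rw [hβE m hm]) hne2 (fun i hi => hxz i (by omega))
    rcases combine hx hi hj with ⟨σ, hσ, t, hp⟩ | ⟨R', h1, h2, h3⟩
    · obtain ⟨y, hy0, hyE, hyn, -, -, hyp, hyt⟩ := move hn hx hx0 hσ hp 1 one_pos
      have hinj : ∀ m ≤ n, ∀ m' ≤ n, y (t m) = y (t m') → m = m' := by
        intro m h m' h' he
        rcases lt_trichotomy m m' with h1 | h1 | h1
        · exact absurd he (hyt m m' h1 h').ne
        · exact h1
        · exact absurd he (hyt m' m h1 h).ne'
      refine ⟨y, hy0, hyE, keep_zero hp hxz hyn, (Finset.range (n + 1)).image t, ?_, ?_, ?_⟩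
      · rw [Finset.card_image_of_injOn, Finset.card_range]
        · omega
        · intro m h m' h' he
          simp only [Finset.coe_range, Set.mem_Iio] at h h'
          exact hinj m (by omega) m' (by omega) (by rw [he])
      · intro p hp q hq he
        simp only [Finset.coe_image, Set.mem_image, Finset.coe_range, Set.mem_Iio] at hp hq
        obtain ⟨m, h, rfl⟩ := hp
        obtain ⟨m', h', rfl⟩ := hq
        rw [hinj m (by omega) m' (by omega) he]
      · intro p hp
        simp only [Finset.mem_image, Finset.mem_range] at hp
        obtain ⟨m, h, rfl⟩ := hp
        exact hyp m (by omega)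
    · exact ⟨x, hx0, fun _ _ => rfl, hxz, R', by omega, h2, h3⟩
  · push Not at hab
    refine ⟨x, hx0, fun _ _ => rfl, hxz, insert b R, ?_, ?_, ?_⟩
    · rw [Finset.card_insert_of_notMem hb]
    · rw [Finset.coe_insert, Set.injOn_insert (by simpa using hb)]
      refine ⟨hR, ?_⟩
      rintro ⟨a, ha, h⟩
      exact hab a ha h
    · intro p hp
      rcases Finset.mem_insert.1 hp with rfl | h1
      · exact hbp
      · exact hRp p h1

lemma main_lemma {n K N : ℕ} (hn : 1 ≤ n) (hNK : N < K) {γ β : Fin K → ℝ}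
    (hγ : Monotone γ) (hγ0 : ∀ i, 0 ≤ γ i)
    (hγc : (Finset.univ.filter (fun i => γ i ≠ 0)).card ≤ N)
    (hγi : Set.InjOn γ {i | 0 < γ i})
    (hβ : Monotone β) (hβ0 : ∀ i, 0 < β i)
    (hle : ∀ m < n, (-1 : ℝ) ^ m * PS β m ≤ (-1) ^ m * PS γ m) :
    ∃ M ≤ N, ∃ δ : Fin M → ℝ, Function.Injective δ ∧ (∀ j, 0 < δ j) ∧
      ∀ m < n, PS δ m = PS β m := by
  classical
  have hγz := zero_of_card hγ hγ0 hγc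
  by_contra hdone
  have hD : ∀ r : ℕ, r ≤ K - N → ∃ x : Fin K → ℝ, (∀ i, 0 ≤ x i) ∧ (∀ m < n, PS x m = PS β m) ∧
      (Finset.univ.filter (fun i => x i ≠ 0)).card ≤ K - r := by
    intro r
    induction r with
    | zero =>
      intro _
      exact ⟨β, fun i => (hβ0 i).le, fun _ _ => rfl, (Finset.card_le_univ _).trans (by simp)⟩
    | succ r ih =>
      intro hr
      apply descend hn (N := N) (by omega) (PS β) hγ hγ0 hγz hle
      rw [show K - (r + 1) + 1 = K - r by omega]
      exact ih (by omega)
  have hG : ∀ j : ℕ, ∃ x : Fin K → ℝ, (∀ i, 0 ≤ x i) ∧ (∀ m < n, PS x m = PS β m) ∧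
      (Finset.univ.filter (fun i => x i ≠ 0)).card ≤ N ∧
      ∃ R : Finset (Fin K), j ≤ R.card ∧ Set.InjOn x R ∧ ∀ r ∈ R, 0 < x r := by
    intro j
    induction j with
    | zero =>
      obtain ⟨x, h1, h2, h3⟩ := hD (K - N) le_rfl
      exact ⟨x, h1, h2, h3.trans (by omega), ∅, by simp⟩
    | succ j ih =>
      obtain ⟨x', hx0', hxE', hxc', R', hRc', hR', hRp'⟩ := ih
      let s := Tuple.sort x'
      obtain ⟨x, hxdef⟩ : ∃ x, x = x' ∘ s := ⟨_, rfl⟩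
      have hx : Monotone x := by rw [hxdef]; exact Tuple.monotone_sort x'
      have hx0 : ∀ i, 0 ≤ x i := by rw [hxdef]; exact fun i => hx0' _
      have hxE : ∀ m < n, PS x m = PS β m := by
        intro m hm; rw [hxdef, PS_perm]; exact hxE' m hm
      have hxc : (Finset.univ.filter (fun i => x i ≠ 0)).card ≤ N := by
        rw [hxdef]; exact (card_perm x' s).trans hxc'
      obtain ⟨R, hRdef⟩ : ∃ R, R = R'.map s.symm.toEmbedding := ⟨_, rfl⟩
      have hRc : R.card = R'.card := by rw [hRdef, Finset.card_map]
      have hmem : ∀ p ∈ R, s p ∈ R' := by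
        intro p hp
        rw [hRdef, Finset.mem_map] at hp
        obtain ⟨q, hq, rfl⟩ := hp
        simpa using hq
      have hR : Set.InjOn x R := by
        intro p hp q hq he
        rw [hxdef] at he
        exact s.injective (hR' (hmem p hp) (hmem q hq) he)
      have hRp : ∀ r ∈ R, 0 < x r := by
        intro r hr
        rw [hxdef]
        exact hRp' _ (hmem r hr)
      have hninj : ¬ Set.InjOn x {i | 0 < x i} := by
        intro h
        obtain ⟨M, hM, δ, h1, h2, h3⟩ := finish hx0 hxc h
        exact hdone ⟨M, hM, δ, h1, h2, fun m hm => by rw [h3, hxE m hm]⟩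
      have hne : x ≠ γ := by
        rintro rfl
        exact hninj hγi
      obtain ⟨y, hy0, hyE, hyz, R2, h1, h2, h3⟩ := step hn hNK hx hx0 (zero_of_card hx hx0 hxc)
        hγ hγ0 hγz (fun m hm => by rw [hxE m hm]; exact hle m hm) hne hβ hβ0
        (fun m hm => (hxE m hm).symm) R hR hRp hninj
      exact ⟨y, hy0, fun m hm => by rw [hyE m hm, hxE m hm], card_of_zero hyz, R2, by omega, h2, h3⟩
  obtain ⟨x, -, -, -, R, hRc, -, -⟩ := hG (K + 1)
  have := Finset.card_le_univ R
  rw [Fintype.card_fin] at this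
  omega


lemma attains_PS {n N : ℕ} {e : Fin n → ℝ} : AttainsDeg n N e ↔
    ∃ β : Fin N → ℝ, Function.Injective β ∧ (∀ j, 0 < β j) ∧
    ∀ m : Fin n, e m = (-1 : ℝ) ^ (m : ℕ) * 2 ^ (2 * (m : ℕ) + 3) /
      (2 * (m : ℕ) + 3 : ℝ) * PS β m := Iff.rfl

lemma pad {M K : ℕ} (hMK : M ≤ K) (γ : Fin M → ℝ) (hi : Function.Injective γ)
    (hp : ∀ j, 0 < γ j) : ∃ g : Fin K → ℝ, Monotone g ∧ (∀ i, 0 ≤ g i) ∧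
      (Finset.univ.filter (fun i => g i ≠ 0)).card ≤ M ∧ Set.InjOn g {i | 0 < g i} ∧
      ∀ m, PS g m = PS γ m := by
  classical
  let h : Fin K → ℝ := fun i => if hi : (i : ℕ) < M then γ ⟨i, hi⟩ else 0
  have hpos : ∀ i : Fin K, h i ≠ 0 → (i : ℕ) < M := by
    intro i hh
    by_contra h'
    exact hh (dif_neg h')
  have hcast : ∀ j : Fin M, h (Fin.castLE hMK j) = γ j := fun j => dif_pos j.2
  have h0 : ∀ i, 0 ≤ h i := by
    intro i
    by_cases h' : (i : ℕ) < M
    · rw [show h i = γ ⟨i, h'⟩ from dif_pos h']; exact (hp _).le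
    · rw [show h i = 0 from dif_neg h']
  have hF : Finset.univ.filter (fun i => h i ≠ 0) ⊆ Finset.univ.image (Fin.castLE hMK) := by
    intro i hh
    have := hpos i (Finset.mem_filter.1 hh).2
    exact Finset.mem_image.2 ⟨⟨i, this⟩, Finset.mem_univ _, rfl⟩
  have hc : (Finset.univ.filter (fun i => h i ≠ 0)).card ≤ M :=
    (Finset.card_le_card hF).trans (Finset.card_image_le.trans (by simp))
  have hinj : Set.InjOn h {i | 0 < h i} := by
    intro p hp' q hq he
    have h1 := hpos p (ne_of_gt hp')
    have h2 := hpos q (ne_of_gt hq)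
    rw [show h p = γ ⟨p, h1⟩ from dif_pos h1, show h q = γ ⟨q, h2⟩ from dif_pos h2] at he
    have := hi he
    simp only [Fin.mk.injEq] at this
    exact Fin.ext this
  have hPS : ∀ m, PS h m = PS γ m := by
    intro m
    unfold PS
    rw [← Finset.sum_subset (Finset.subset_univ (Finset.univ.image (Fin.castLE hMK)))]
    · rw [Finset.sum_image (fun i _ j _ h => Fin.castLE_injective hMK h)]
      exact Finset.sum_congr rfl fun j _ => by rw [hcast]
    · intro i _ hi'
      have : h i = 0 := by
        by_contra hh
        exact hi' (hF (by simpa using hh))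
      rw [this, zero_pow (by omega)]
  refine ⟨h ∘ Tuple.sort h, Tuple.monotone_sort h, fun i => h0 _, (card_perm h _).trans hc, ?_,
    fun m => by rw [PS_perm, hPS]⟩
  intro p hp' q hq he
  exact (Tuple.sort h).injective (hinj hp' hq he)

/-- **`𝓜ⁿ_N` is downward closed within `⋃_Ñ 𝓜ⁿ_Ñ`.**
Fix `n ≥ 1` and `N ≥ 1`.  If `ẽ` is attainable by a multisoliton of some degree `Ñ`,
`e` is attainable by a multisoliton of degree at most `N`, and `ẽ_m ≤ e_m` for all `m`,
then `ẽ` is attainable by a multisoliton of degree at most `N`. -/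
theorem stmt_10 (n N : ℕ) (hn : 1 ≤ n) (hN : 1 ≤ N) (e e' : Fin n → ℝ)
    (he' : ∃ N' : ℕ, AttainsDeg n N' e')
    (he : ∃ M ≤ N, AttainsDeg n M e)
    (hle : ∀ m, e' m ≤ e m) :
    ∃ M' ≤ N, AttainsDeg n M' e' := by
  obtain ⟨K, β', hβi', hβp', hβE'⟩ := he'
  obtain ⟨M, hMN, hM⟩ := he
  obtain ⟨γ', hγi', hγp', hγE'⟩ := attains_PS.1 hM
  by_cases hNK : K ≤ N
  · exact ⟨K, hNK, β', hβi', hβp', hβE'⟩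
  have hβE : ∀ m : Fin n, e' m = (-1 : ℝ) ^ (m : ℕ) * 2 ^ (2 * (m : ℕ) + 3) /
      (2 * (m : ℕ) + 3 : ℝ) * PS (β' ∘ Tuple.sort β') m := by
    intro m
    rw [PS_perm]
    exact hβE' m
  obtain ⟨γ, hγ, hγ0, hγc, hγi, hγPS⟩ := pad (K := K) (by omega) γ' hγi' hγp'
  obtain ⟨M', hM', δ, h1, h2, h3⟩ := main_lemma (N := N) hn (by omega) hγ hγ0 (hγc.trans hMN) hγi
    (Tuple.monotone_sort β') (fun i => hβp' _) (fun m hm => by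
      have h := hle ⟨m, hm⟩
      rw [hβE, hγE', ← hγPS] at h
      simp only at h
      have hc : (0 : ℝ) < 2 ^ (2 * m + 3) / (2 * (m : ℝ) + 3) := by positivity
      refine le_of_mul_le_mul_left ?_ hc
      calc _ = (-1 : ℝ) ^ m * 2 ^ (2 * m + 3) / (2 * m + 3 : ℝ) * PS (β' ∘ Tuple.sort β') m := by
            ring
        _ ≤ _ := h
        _ = _ := by ring)
  refine ⟨M', hM', attains_PS.2 ⟨δ, h1, h2, fun m => ?_⟩⟩
  rw [h3 m m.2, hβE m]
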